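/- Let G be a word-hyperbolic group with marked finite generating set A, X = Γ(G,A) its Cayley graph with word metric d_X, and H ≤ G a quasiconvex subgroup. Then there exists an integer constant K = K(G,H,A) > 0 with the following properties: if g ∈ G is a shortest element (with respect to d_X) of its coset Hg and h ∈ H is arbitrary, then (1) |hg|_X ≥ |h|_X + |g|_X − K, and (2) the concatenated path [1,h] ∪ h[1,g] is K-Hausdorff close to a geodesic [1,hg]. -/

import Mathlib

/-! ## Words over a marked generating set and word metrics -/

/-- Evaluation of a word in the letters `A × Bool` (a letter together with a sign,
`true` = the letter itself, `false` = its inverse) under a marking `π : A → G`. -/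
def evalWord {A G : Type*} [Group G] (π : A → G) (w : List (A × Bool)) : G :=
  (w.map fun p => if p.2 then π p.1 else (π p.1)⁻¹).prod

/-- The word length `|g|_X` of `g ∈ G` with respect to the marked generating set `π : A → G`. -/
noncomputable def wordLen {A G : Type*} [Group G] (π : A → G) (g : G) : ℕ :=
  sInf {n | ∃ w : List (A × Bool), w.length = n ∧ evalWord π w = g}

/-- The word metric `d_X` on the Cayley graph `X = Γ(G,A)` (restricted to vertices). -/
noncomputable def dX {A G : Type*} [Group G] (π : A → G) (g₁ g₂ : G) : ℕ :=
  wordLen π (g₁⁻¹ * g₂)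

/-! ## Discrete geodesics, paths, near-geodesics, thinness, trimness -/

/-- A (discrete) geodesic from `x` to `y` in a graph-like metric `d`:
a sequence of vertices `γ 0 = x, …, γ (d x y) = y` with `d (γ i) (γ j) = |i - j|`. -/
def IsDiscGeodesic {X : Type*} (d : X → X → ℕ) (x y : X) (γ : ℕ → X) : Prop :=
  γ 0 = x ∧ γ (d x y) = y ∧
    ∀ i j, i ≤ d x y → j ≤ d x y → d (γ i) (γ j) = Nat.dist i j

/-- A discrete edge-path of length `n`: consecutive vertices at distance at most `1`. -/
def IsDiscPath {X : Type*} (d : X → X → ℕ) (γ : ℕ → X) (n : ℕ) : Prop :=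
  ∀ i < n, d (γ i) (γ (i + 1)) ≤ 1

/-- A near-geodesic from `x` to `y`: a path `p₁ p' p₂` where `p'` is geodesic and the
initial and terminal segments `p₁, p₂` have length at most `1`. -/
def IsNearGeodesicPath {X : Type*} (d : X → X → ℕ) (x y : X) (γ : ℕ → X) (n : ℕ) : Prop :=
  γ 0 = x ∧ γ n = y ∧ IsDiscPath d γ n ∧
    ∃ a b : ℕ, a ≤ 1 ∧ b ≤ 1 ∧ a + b ≤ n ∧
      ∀ i j, a ≤ i → i ≤ j → j + b ≤ n → d (γ i) (γ j) = j - i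

/-- All geodesic triangles of `(X,d)` are `δ`-thin: every side is contained in the closed
`δ`-neighbourhood of the union of the other two sides. -/
def DiscThinTriangles {X : Type*} (d : X → X → ℕ) (δ : ℝ) : Prop :=
  ∀ x y z (γ₁ γ₂ γ₃ : ℕ → X),
    IsDiscGeodesic d x y γ₁ → IsDiscGeodesic d y z γ₂ → IsDiscGeodesic d z x γ₃ →
    ∀ i ≤ d x y, ∃ j,
      (j ≤ d y z ∧ (d (γ₁ i) (γ₂ j) : ℝ) ≤ δ) ∨
      (j ≤ d z x ∧ (d (γ₁ i) (γ₃ j) : ℝ) ≤ δ)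

/-- All geodesic bigons of `(X,d)` are `δ`-thin: each side is contained in the closed
`δ`-neighbourhood of the other. -/
def DiscThinBigons {X : Type*} (d : X → X → ℕ) (δ : ℝ) : Prop :=
  ∀ x y (α β : ℕ → X), IsDiscGeodesic d x y α → IsDiscGeodesic d x y β →
    (∀ i ≤ d x y, ∃ j ≤ d x y, (d (α i) (β j) : ℝ) ≤ δ) ∧
    (∀ i ≤ d x y, ∃ j ≤ d x y, (d (β i) (α j) : ℝ) ≤ δ)

/-- The Gromov product `(x,y)_z` with respect to the `ℕ`-valued metric `d`. -/
noncomputable def gromovProd {X : Type*} (d : X → X → ℕ) (x y z : X) : ℝ :=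
  ((d z x : ℝ) + (d z y : ℝ) - (d x y : ℝ)) / 2

/-- All geodesic triangles of `(X,d)` are `δ`-trim: two points on two sides which are at the
same distance, at most the Gromov product `(x,y)_z`, from the common vertex `z`, are
`δ`-close (this is required for every labelling of the vertices of the triangle). -/
def DiscTrimTriangles {X : Type*} (d : X → X → ℕ) (δ : ℕ) : Prop :=
  ∀ x y z (γ₁ γ₂ : ℕ → X), IsDiscGeodesic d z x γ₁ → IsDiscGeodesic d z y γ₂ →
    ∀ i, i ≤ d z x → i ≤ d z y → (i : ℝ) ≤ gromovProd d x y z →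
      d (γ₁ i) (γ₂ i) ≤ δ

/-- `S ⊆ G` is `C`-quasiconvex w.r.t. `d`: every geodesic with endpoints in `S`
stays in the closed `C`-neighbourhood of `S`. -/
def DiscQuasiconvex {G : Type*} (d : G → G → ℕ) (S : Set G) (C : ℝ) : Prop :=
  ∀ x y (γ : ℕ → G), x ∈ S → y ∈ S → IsDiscGeodesic d x y γ →
    ∀ i ≤ d x y, ∃ h ∈ S, (d (γ i) h : ℝ) ≤ C

/-! ## The relative Cayley graph (Schreier coset graph) -/

/-- The right coset `Hg` of `g`, as a vertex of the relative Cayley graph `Γ(G/H,A)`. -/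
def rcoset {G : Type*} [Group G] (H : Subgroup G) (g : G) :
    Quotient (QuotientGroup.rightRel H) :=
  Quotient.mk (QuotientGroup.rightRel H) g

/-- Right multiplication `Hg ↦ Hga` on right cosets; this is the map tracing the
edges of the relative Cayley graph. -/
def cosetMul {G : Type*} [Group G] (H : Subgroup G)
    (x : Quotient (QuotientGroup.rightRel H)) (g : G) :
    Quotient (QuotientGroup.rightRel H) :=
  Quotient.map (· * g) (fun a b hab => by
    have hab' : b * a⁻¹ ∈ H := QuotientGroup.rightRel_apply.mp hab
    show QuotientGroup.rightRel H (a * g) (b * g)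
    rw [QuotientGroup.rightRel_apply]
    simpa [mul_inv_rev, mul_assoc] using hab') x

/-- The simplicial metric `d_Y` on (the vertices of) the relative Cayley graph
`Y = Γ(G/H, A)`: the least length of a word in the generators leading from one coset
to the other. -/
noncomputable def dY {A G : Type*} [Group G] (π : A → G) (H : Subgroup G)
    (x y : Quotient (QuotientGroup.rightRel H)) : ℕ :=
  sInf {n | ∃ w : List (A × Bool), w.length = n ∧ cosetMul H x (evalWord π w) = y}

/-- `g` is a shortest element of its right coset `Hg` with respect to the word length. -/
def ShortestInCoset {A G : Type*} [Group G] (π : A → G) (H : Subgroup G) (g : G) : Prop :=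
  ∀ h ∈ H, wordLen π g ≤ wordLen π (h * g)

/-! ## Basic properties of the word metric -/

theorem evalWord_append {A G : Type*} [Group G] (π : A → G) (u v : List (A × Bool)) :
    evalWord π (u ++ v) = evalWord π u * evalWord π v := by
  simp [evalWord]

theorem exists_evalWord_inv {A G : Type*} [Group G] (π : A → G) (w : List (A × Bool)) :
    ∃ v : List (A × Bool), v.length = w.length ∧ evalWord π v = (evalWord π w)⁻¹ := by
  induction w with
  | nil => exact ⟨[], rfl, by simp [evalWord]⟩
  | cons p w ih =>
    obtain ⟨v, hv, hev⟩ := ih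
    refine ⟨v ++ [(p.1, !p.2)], by simp [hv], ?_⟩
    rw [evalWord_append, hev]
    rcases p with ⟨a, _ | _⟩ <;> simp [evalWord]

theorem exists_evalWord_eq {A G : Type*} [Group G] (π : A → G)
    (hgen : Subgroup.closure (Set.range π) = ⊤) (g : G) :
    ∃ w : List (A × Bool), evalWord π w = g := by
  have hg : g ∈ Subgroup.closure (Set.range π) := hgen ▸ Subgroup.mem_top g
  induction hg using Subgroup.closure_induction with
  | mem x hx =>
    obtain ⟨a, rfl⟩ := hx
    exact ⟨[(a, true)], by simp [evalWord]⟩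
  | one => exact ⟨[], rfl⟩
  | mul x y _ _ hx hy =>
    obtain ⟨u, rfl⟩ := hx
    obtain ⟨v, rfl⟩ := hy
    exact ⟨u ++ v, evalWord_append π u v⟩
  | inv x _ hx =>
    obtain ⟨u, rfl⟩ := hx
    obtain ⟨v, -, hv⟩ := exists_evalWord_inv π u
    exact ⟨v, hv⟩

theorem wordLen_evalWord_le {A G : Type*} [Group G] (π : A → G) (w : List (A × Bool)) :
    wordLen π (evalWord π w) ≤ w.length :=
  Nat.sInf_le ⟨w, rfl, rfl⟩

theorem exists_length_eq_wordLen {A G : Type*} [Group G] (π : A → G)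
    (hgen : Subgroup.closure (Set.range π) = ⊤) (g : G) :
    ∃ w : List (A × Bool), w.length = wordLen π g ∧ evalWord π w = g := by
  obtain ⟨w, hw⟩ := exists_evalWord_eq π hgen g
  exact Nat.sInf_mem
    (s := {n | ∃ w : List (A × Bool), w.length = n ∧ evalWord π w = g}) ⟨_, w, rfl, hw⟩

theorem wordLen_mul_le {A G : Type*} [Group G] (π : A → G)
    (hgen : Subgroup.closure (Set.range π) = ⊤) (g h : G) :
    wordLen π (g * h) ≤ wordLen π g + wordLen π h := by
  obtain ⟨u, hu, rfl⟩ := exists_length_eq_wordLen π hgen g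
  obtain ⟨v, hv, rfl⟩ := exists_length_eq_wordLen π hgen h
  rw [← hu, ← hv, ← evalWord_append, ← List.length_append]
  exact wordLen_evalWord_le π _

theorem wordLen_inv_le {A G : Type*} [Group G] (π : A → G)
    (hgen : Subgroup.closure (Set.range π) = ⊤) (g : G) :
    wordLen π g⁻¹ ≤ wordLen π g := by
  obtain ⟨u, hu, rfl⟩ := exists_length_eq_wordLen π hgen g
  obtain ⟨v, hv, hev⟩ := exists_evalWord_inv π u
  rw [← hu, ← hv, ← hev]
  exact wordLen_evalWord_le π v

theorem dX_comm {A G : Type*} [Group G] (π : A → G)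
    (hgen : Subgroup.closure (Set.range π) = ⊤) (x y : G) : dX π x y = dX π y x := by
  have key : ∀ x y : G, dX π x y ≤ dX π y x := fun x y => by
    simpa [dX] using wordLen_inv_le π hgen (y⁻¹ * x)
  exact le_antisymm (key x y) (key y x)

theorem dX_triangle {A G : Type*} [Group G] (π : A → G)
    (hgen : Subgroup.closure (Set.range π) = ⊤) (x y z : G) :
    dX π x z ≤ dX π x y + dX π y z := by
  simpa [dX, mul_assoc] using wordLen_mul_le π hgen (x⁻¹ * y) (y⁻¹ * z)

/-- The Cayley graph is a geodesic space: a shortest word traces a geodesic. -/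
theorem exists_isDiscGeodesic_dX {A G : Type*} [Group G] (π : A → G)
    (hgen : Subgroup.closure (Set.range π) = ⊤) (x y : G) :
    ∃ γ : ℕ → G, IsDiscGeodesic (dX π) x y γ := by
  obtain ⟨w, hw, hev⟩ := exists_length_eq_wordLen π hgen (x⁻¹ * y)
  have hn : w.length = dX π x y := hw
  set γ : ℕ → G := fun i => x * evalWord π (w.take i) with hγ
  have h0 : γ 0 = x := by simp [hγ, evalWord]
  have h1 : γ (dX π x y) = y := by simp [hγ, ← hn, hev]
  have hle : ∀ i j, i ≤ j → dX π (γ i) (γ j) ≤ j - i := fun i j hij => by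
    have : (γ i)⁻¹ * γ j = evalWord π ((w.take j).drop i) := by
      have h := evalWord_append π ((w.take j).take i) ((w.take j).drop i)
      rw [List.take_append_drop, List.take_take, min_eq_left hij] at h
      simp [hγ, h, mul_assoc]
    rw [dX, this]
    refine (wordLen_evalWord_le π _).trans ?_
    simp only [List.length_drop, List.length_take]
    omega
  have heq : ∀ i j, i ≤ j → j ≤ dX π x y → dX π (γ i) (γ j) = j - i := fun i j hij hj => by
    have a := hle 0 i (Nat.zero_le _)
    have b := hle i j hij
    have c := hle j _ hj
    have t := dX_triangle π hgen x (γ i) y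
    have t' := dX_triangle π hgen (γ i) (γ j) y
    rw [h0] at a
    rw [h1] at c
    omega
  refine ⟨γ, h0, h1, fun i j hi hj => ?_⟩
  rcases le_total i j with hij | hij
  · rw [heq i j hij hj, Nat.dist_eq_sub_of_le hij]
  · rw [dX_comm π hgen, heq j i hij hi, Nat.dist_eq_sub_of_le_right hij]

/-! ## Nearest points on quasiconvex sets -/

theorem IsDiscGeodesic.dist_left {X : Type*} {d : X → X → ℕ} {x y : X} {γ : ℕ → X}
    (hγ : IsDiscGeodesic d x y γ) {i : ℕ} (hi : i ≤ d x y) : d x (γ i) = i := by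
  have h := hγ.2.2 0 i (Nat.zero_le _) hi
  rwa [hγ.1, Nat.dist_zero_left] at h

theorem IsDiscGeodesic.dist_right {X : Type*} {d : X → X → ℕ} {x y : X} {γ : ℕ → X}
    (hγ : IsDiscGeodesic d x y γ) {i : ℕ} (hi : i ≤ d x y) : d (γ i) y = d x y - i := by
  have h := hγ.2.2 i (d x y) hi le_rfl
  rwa [hγ.2.1, Nat.dist_eq_sub_of_le hi] at h

theorem IsDiscGeodesic.reverse {X : Type*} {d : X → X → ℕ} (hsymm : ∀ x y, d x y = d y x)
    {x y : X} {γ : ℕ → X} (hγ : IsDiscGeodesic d x y γ) :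
    IsDiscGeodesic d y x (fun i => γ (d x y - i)) := by
  obtain ⟨h0, h1, h⟩ := hγ
  refine ⟨by simpa using h1, by simpa [hsymm y x] using h0, fun i j hi hj => ?_⟩
  rw [hsymm y x] at hi hj
  rw [h _ _ (Nat.sub_le _ _) (Nat.sub_le _ _)]
  simp only [Nat.dist]
  omega

theorem exists_transition {P Q : ℕ → Prop} {n : ℕ} (h0 : P 0) (hn : Q n)
    (hPQ : ∀ i ≤ n, P i ∨ Q i) :
    ∃ i ≤ n, P i ∧ ∃ k ≤ n, Q k ∧ i ≤ k ∧ k ≤ i + 1 := by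
  induction n with
  | zero => exact ⟨0, le_rfl, h0, 0, le_rfl, hn, le_rfl, by omega⟩
  | succ n ih =>
    rcases hPQ n (by omega) with hP | hQ
    · exact ⟨n, by omega, hP, n + 1, le_rfl, hn, by omega, le_rfl⟩
    · obtain ⟨i, hi, hPi, k, hk, hQk, h⟩ := ih hQ fun i hi => hPQ i (by omega)
      exact ⟨i, by omega, hPi, k, by omega, hQk, h⟩

/-- If `p` is a point of the quasiconvex set `S` nearest to `y`, then for `x ∈ S` the broken
geodesic through `x, p, y` is Hausdorff close to the geodesic from `x` to `y`, and is
almost as short. -/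
theorem nearest_point_geometry {X : Type*} {d : X → X → ℕ}
    (hsymm : ∀ x y, d x y = d y x) (htri : ∀ x y z, d x z ≤ d x y + d y z)
    {D C : ℕ} (hthin : DiscThinTriangles d D) {S : Set X} (hS : DiscQuasiconvex d S C)
    {x p y : X} (hx : x ∈ S) (hpS : p ∈ S) (hp : ∀ s ∈ S, d p y ≤ d s y)
    {γ₁ γ₂ γ₃ : ℕ → X} (h₁ : IsDiscGeodesic d x p γ₁) (h₂ : IsDiscGeodesic d p y γ₂)
    (h₃ : IsDiscGeodesic d x y γ₃) :
    d x p + d p y ≤ d x y + (6 * D + 2 * C + 4) ∧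
    (∀ i ≤ d x y, ∃ j, (j ≤ d x p ∧ d (γ₃ i) (γ₁ j) ≤ 6 * D + 2 * C + 4) ∨
      (j ≤ d p y ∧ d (γ₃ i) (γ₂ j) ≤ 6 * D + 2 * C + 4)) ∧
    (∀ j ≤ d x p, ∃ i ≤ d x y, d (γ₁ j) (γ₃ i) ≤ 6 * D + 2 * C + 4) ∧
    (∀ j ≤ d p y, ∃ i ≤ d x y, d (γ₂ j) (γ₃ i) ≤ 6 * D + 2 * C + 4) := by
  have h₃' := h₃.reverse hsymm
  have thin₁ : ∀ j ≤ d x p, (∃ k ≤ d p y, d (γ₁ j) (γ₂ k) ≤ D) ∨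
      ∃ i ≤ d x y, d (γ₁ j) (γ₃ i) ≤ D := fun j hj => by
    obtain ⟨k, ⟨hk, h⟩ | ⟨hk, h⟩⟩ := hthin _ _ _ _ _ _ h₁ h₂ h₃' j hj
    · exact .inl ⟨k, hk, by exact_mod_cast h⟩
    · exact .inr ⟨d x y - k, Nat.sub_le _ _, by exact_mod_cast h⟩
  have thin₂ : ∀ k ≤ d p y, (∃ i ≤ d x y, d (γ₂ k) (γ₃ i) ≤ D) ∨
      ∃ j ≤ d x p, d (γ₂ k) (γ₁ j) ≤ D := fun k hk => by
    obtain ⟨j, ⟨hj, h⟩ | ⟨hj, h⟩⟩ := hthin _ _ _ _ _ _ h₂ h₃' h₁ k hk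
    · exact .inl ⟨d x y - j, Nat.sub_le _ _, by exact_mod_cast h⟩
    · exact .inr ⟨j, hj, by exact_mod_cast h⟩
  have thin₃ : ∀ i ≤ d x y, (∃ j ≤ d x p, d (γ₃ i) (γ₁ j) ≤ D) ∨
      ∃ k ≤ d p y, d (γ₃ i) (γ₂ k) ≤ D := fun i hi => by
    obtain ⟨j, hj⟩ := hthin _ _ _ _ _ _ h₃' h₁ h₂ (d x y - i)
      ((Nat.sub_le _ _).trans_eq (hsymm x y))
    simp only [Nat.sub_sub_self hi, Nat.cast_le] at hj
    rcases hj with ⟨hj, h⟩ | ⟨hj, h⟩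
    · exact .inl ⟨j, hj, h⟩
    · exact .inr ⟨j, hj, h⟩
  have near : ∀ j ≤ d x p, ∀ k ≤ d p y, d p (γ₂ k) ≤ d (γ₁ j) (γ₂ k) + C := fun j hj k hk => by
    obtain ⟨s, hs, hd⟩ := hS _ _ _ hx hpS h₁ j hj
    have hd : d (γ₁ j) s ≤ C := by exact_mod_cast hd
    have := hp s hs
    have := h₂.dist_left hk
    have := h₂.dist_right hk
    have := htri s (γ₂ k) y
    have := htri s (γ₁ j) (γ₂ k)
    have := hsymm s (γ₁ j)
    omega
  have self₃ : ∀ i ≤ d x y, d (γ₃ i) (γ₃ i) = 0 := fun i hi => by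
    rw [h₃.2.2 i i hi hi, Nat.dist_self]
  obtain ⟨i, hi, ⟨j, hj, hij⟩, l, hl, ⟨k, hk, hlk⟩, hil, hli⟩ :=
    exists_transition (n := d x y) (P := fun i => ∃ j ≤ d x p, d (γ₃ i) (γ₁ j) ≤ D)
      (Q := fun i => ∃ k ≤ d p y, d (γ₃ i) (γ₂ k) ≤ D)
      ⟨0, Nat.zero_le _, by
        have := self₃ 0 (Nat.zero_le _)
        rw [h₁.1, ← h₃.1]
        omega⟩
      ⟨d p y, le_rfl, by
        have := self₃ _ le_rfl
        rw [h₂.2.1]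
        nth_rewrite 2 [← h₃.2.1]
        omega⟩ thin₃
  have hpi : d p (γ₃ i) ≤ 3 * D + C + 2 := by
    have := near j hj k hk
    have e := h₃.2.2 i l hi hl
    rw [Nat.dist_eq_sub_of_le hil] at e
    have := htri (γ₃ i) (γ₃ l) (γ₂ k)
    have := htri (γ₁ j) (γ₃ i) (γ₂ k)
    have := htri p (γ₂ k) (γ₃ i)
    have := hsymm (γ₁ j) (γ₃ i)
    have := hsymm (γ₂ k) (γ₃ i)
    omega
  refine ⟨?_, fun m hm => ?_, fun m hm => ?_, fun m hm => ?_⟩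
  · have := h₃.dist_left hi
    have := h₃.dist_right hi
    have := htri x (γ₃ i) p
    have := htri p (γ₃ i) y
    have := hsymm p (γ₃ i)
    omega
  · rcases thin₃ m hm with ⟨a, ha, h⟩ | ⟨a, ha, h⟩
    · exact ⟨a, .inl ⟨ha, by omega⟩⟩
    · exact ⟨a, .inr ⟨ha, by omega⟩⟩
  · rcases thin₁ m hm with ⟨a, ha, h⟩ | ⟨a, ha, h⟩
    · have := near m hm a ha
      have := htri (γ₁ m) (γ₂ a) p
      have := htri (γ₁ m) p (γ₃ i)
      have := hsymm p (γ₂ a)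
      exact ⟨i, hi, by omega⟩
    · exact ⟨a, ha, by omega⟩
  · rcases thin₂ m hm with ⟨a, ha, h⟩ | ⟨a, ha, h⟩
    · exact ⟨a, ha, by omega⟩
    · have := near a ha m hm
      have := htri (γ₂ m) p (γ₃ i)
      have := hsymm p (γ₂ m)
      have := hsymm (γ₁ a) (γ₂ m)
      exact ⟨i, hi, by omega⟩


/-- **Lemma 3.2.** Let `G` be a word-hyperbolic group with marked finite generating set `A`,
`X = Γ(G,A)` its Cayley graph with word metric `d_X`, and `H ≤ G` a quasiconvex subgroup.
Then there exists an integer constant `K = K(G,H,A) > 0` with the following properties: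
if `g ∈ G` is a shortest element of its coset `Hg` and `h ∈ H` is arbitrary, then
(1) `|hg|_X ≥ |h|_X + |g|_X − K`, and
(2) the concatenated path `[1,h] ∪ h[1,g]` is `K`-Hausdorff close to a geodesic `[1,hg]`. -/
theorem shortest_coset_representative_geometry
    {A G : Type*} [Group G] [Fintype A] (π : A → G)
    (hgen : Subgroup.closure (Set.range π) = ⊤)
    (hhyp : ∃ δ : ℝ, 0 ≤ δ ∧ DiscThinTriangles (dX π) δ)
    (H : Subgroup G)
    (hqc : ∃ C : ℝ, 0 < C ∧ DiscQuasiconvex (dX π) (H : Set G) C) :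
    ∃ K : ℕ, 0 < K ∧ ∀ g h : G, h ∈ H → ShortestInCoset π H g →
      (wordLen π h + wordLen π g ≤ wordLen π (h * g) + K) ∧
      (∀ γ₁ γ₂ γ₃ : ℕ → G,
        IsDiscGeodesic (dX π) 1 h γ₁ → IsDiscGeodesic (dX π) h (h * g) γ₂ →
        IsDiscGeodesic (dX π) 1 (h * g) γ₃ →
        (∀ i ≤ dX π 1 (h * g), ∃ j,
            (j ≤ dX π 1 h ∧ dX π (γ₃ i) (γ₁ j) ≤ K) ∨
            (j ≤ dX π h (h * g) ∧ dX π (γ₃ i) (γ₂ j) ≤ K)) ∧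
        (∀ j ≤ dX π 1 h, ∃ i ≤ dX π 1 (h * g), dX π (γ₁ j) (γ₃ i) ≤ K) ∧
        (∀ j ≤ dX π h (h * g), ∃ i ≤ dX π 1 (h * g), dX π (γ₂ j) (γ₃ i) ≤ K)) := by
  obtain ⟨δ, -, hthin⟩ := hhyp
  obtain ⟨C, -, hqc⟩ := hqc
  have hthin' : DiscThinTriangles (dX π) (⌈δ⌉₊ : ℕ) := fun x y z γ₁ γ₂ γ₃ h₁ h₂ h₃ i hi => by
    obtain ⟨j, hj⟩ := hthin x y z γ₁ γ₂ γ₃ h₁ h₂ h₃ i hi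
    exact ⟨j, hj.imp (fun h => ⟨h.1, h.2.trans (Nat.le_ceil δ)⟩)
      fun h => ⟨h.1, h.2.trans (Nat.le_ceil δ)⟩⟩
  have hqc' : DiscQuasiconvex (dX π) (H : Set G) (⌈C⌉₊ : ℕ) := fun x y γ hx hy hγ i hi => by
    obtain ⟨h, hh, hd⟩ := hqc x y γ hx hy hγ i hi
    exact ⟨h, hh, hd.trans (Nat.le_ceil C)⟩
  refine ⟨6 * ⌈δ⌉₊ + 2 * ⌈C⌉₊ + 4, by omega, fun g h hh hg => ?_⟩
  have hp : ∀ s ∈ (H : Set G), dX π h (h * g) ≤ dX π s (h * g) := fun s hs => by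
    simpa [dX, mul_assoc] using hg (s⁻¹ * h) (H.mul_mem (H.inv_mem hs) hh)
  have key := fun {γ₁ γ₂ γ₃} => nearest_point_geometry (γ₁ := γ₁) (γ₂ := γ₂) (γ₃ := γ₃)
    (dX_comm π hgen) (dX_triangle π hgen) hthin' hqc' H.one_mem hh hp
  refine ⟨?_, fun γ₁ γ₂ γ₃ h₁ h₂ h₃ => (key h₁ h₂ h₃).2⟩
  obtain ⟨γ₁, h₁⟩ := exists_isDiscGeodesic_dX π hgen 1 h
  obtain ⟨γ₂, h₂⟩ := exists_isDiscGeodesic_dX π hgen h (h * g)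
  obtain ⟨γ₃, h₃⟩ := exists_isDiscGeodesic_dX π hgen 1 (h * g)
  simpa [dX] using (key h₁ h₂ h₃).1
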